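/- arXiv:2103.01092 — 3 statements merged into one kernel-verified Lean document; each statement's English description precedes it below -/
import Mathlib

section
/- Let f : ℝ × ℝ → ℝ be continuous, let τ > 0, and let x : ℝ → ℝ be twice differentiable with x''(t) = f(x(t), x'(t)) for all t. Assume x is strictly monotone on the interval [0, τ] and x'(t) ≠ 0 for all t in the open interval (0, τ). Then there exists a function φ defined on the image x([0, τ]) such that x'(t) = φ(x(t)) for all t ∈ [0, τ], φ(x(0)) = x'(0), and at every interior point y of x([0, τ]) the function φ is differentiable with φ(y) · φ'(y) = f(y, φ(y)). -/
open Set Function Topology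

/-- A right inverse on `s` of a map that is continuous and injective on a compact set `s` is
continuous on the image. -/
theorem IsCompact.continuousOn_invFunOn_image {α β : Type*} [TopologicalSpace α] [Nonempty α]
    [TopologicalSpace β] [T2Space β] {s : Set α} {f : α → β} (hs : IsCompact s)
    (hf : ContinuousOn f s) (hinj : InjOn f s) : ContinuousOn (invFunOn f s) (f '' s) := by
  have : CompactSpace s := isCompact_iff_compactSpace.mp hs
  have hemb : IsClosedEmbedding (s.domRestrict f) :=
    hf.domRestrict.isClosedEmbedding hinj.injective
  let g : f '' s → s := fun y => ⟨invFunOn f s y, invFunOn_mem y.2⟩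
  have hg : Continuous g := by
    rw [hemb.isInducing.continuous_iff]
    exact continuous_subtype_val.congr fun y => (invFunOn_eq y.2).symm
  exact continuousOn_iff_continuous_domRestrict.mpr (continuous_subtype_val.comp hg)

/-- A strictly monotone function on `[a, b]` maps only points of `(a, b)` into the interior of
its image. -/
theorem StrictMonoOn.mem_Ioo_of_mem_interior_image {a b t : ℝ} {x : ℝ → ℝ}
    (hx : StrictMonoOn x (Icc a b)) (ht : t ∈ Icc a b)
    (hy : x t ∈ interior (x '' Icc a b)) : t ∈ Ioo a b := by
  have hab : a ≤ b := ht.1.trans ht.2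
  have hsub : x '' Icc a b ⊆ Icc (x a) (x b) := by
    rintro _ ⟨s, hs, rfl⟩
    exact ⟨hx.monotoneOn (left_mem_Icc.mpr hab) hs hs.1,
      hx.monotoneOn hs (right_mem_Icc.mpr hab) hs.2⟩
  have h := interior_mono hsub hy
  rw [interior_Icc] at h
  exact ⟨(hx.lt_iff_lt (left_mem_Icc.mpr hab) ht).mp h.1,
    (hx.lt_iff_lt ht (right_mem_Icc.mpr hab)).mp h.2⟩

/-- A strictly antitone function on `[a, b]` maps only points of `(a, b)` into the interior of
its image. -/
theorem StrictAntiOn.mem_Ioo_of_mem_interior_image {a b t : ℝ} {x : ℝ → ℝ}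
    (hx : StrictAntiOn x (Icc a b)) (ht : t ∈ Icc a b)
    (hy : x t ∈ interior (x '' Icc a b)) : t ∈ Ioo a b := by
  have hab : a ≤ b := ht.1.trans ht.2
  have hsub : x '' Icc a b ⊆ Icc (x b) (x a) := by
    rintro _ ⟨s, hs, rfl⟩
    exact ⟨hx.antitoneOn hs (right_mem_Icc.mpr hab) hs.2,
      hx.antitoneOn (left_mem_Icc.mpr hab) hs hs.1⟩
  have h := interior_mono hsub hy
  rw [interior_Icc] at h
  exact ⟨(hx.lt_iff_gt ht (left_mem_Icc.mpr hab)).mp h.2,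
    (hx.lt_iff_gt (right_mem_Icc.mpr hab) ht).mp h.1⟩

/-- Sufficiency direction on a monotone arc: along any arc of a solution of
`ẍ = f(x, ẋ)` on which `x` is strictly monotone with nonvanishing interior
velocity, the velocity is a function `φ` of position satisfying
`φ·φ' = f(·, φ)` at interior points of the image. -/
theorem velocity_as_function_of_position_on_monotone_arc
    (f : ℝ × ℝ → ℝ) (hf : Continuous f)
    (τ : ℝ) (hτ : 0 < τ)
    (x : ℝ → ℝ) (hx : Differentiable ℝ x) (hx' : Differentiable ℝ (deriv x))
    (hode : ∀ t : ℝ, deriv (deriv x) t = f (x t, deriv x t))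
    (hmono : StrictMonoOn x (Set.Icc 0 τ) ∨ StrictAntiOn x (Set.Icc 0 τ))
    (hne : ∀ t ∈ Set.Ioo 0 τ, deriv x t ≠ 0) :
    ∃ φ : ℝ → ℝ,
      (∀ t ∈ Set.Icc 0 τ, deriv x t = φ (x t)) ∧
      φ (x 0) = deriv x 0 ∧
      ∀ y ∈ interior (x '' Set.Icc 0 τ),
        DifferentiableAt ℝ φ y ∧ φ y * deriv φ y = f (y, φ y) := by
  have hinj : InjOn x (Icc 0 τ) := hmono.elim StrictMonoOn.injOn StrictAntiOn.injOn
  set g := invFunOn x (Icc 0 τ)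
  have hgx : ∀ t ∈ Icc 0 τ, g (x t) = t := hinj.leftInvOn_invFunOn
  have hg : ContinuousOn g (x '' Icc 0 τ) :=
    isCompact_Icc.continuousOn_invFunOn_image hx.continuous.continuousOn hinj
  refine ⟨fun y => deriv x (g y), fun t ht => by simp only [hgx t ht],
    by simp only [hgx 0 (left_mem_Icc.mpr hτ.le)], fun y hy => ?_⟩
  obtain ⟨t, ht, rfl⟩ := interior_subset hy
  have htI : t ∈ Ioo 0 τ :=
    hmono.elim (fun h => h.mem_Ioo_of_mem_interior_image ht hy)
      (fun h => h.mem_Ioo_of_mem_interior_image ht hy)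
  have hnhds : x '' Icc 0 τ ∈ 𝓝 (x t) := mem_interior_iff_mem_nhds.mp hy
  have hv : deriv x t ≠ 0 := hne t htI
  have hgd : HasDerivAt g (deriv x t)⁻¹ (x t) := by
    refine HasDerivAt.of_local_left_inverse (hg.continuousAt hnhds) ?_ hv
      (Filter.mem_of_superset hnhds fun z hz => invFunOn_eq hz)
    rw [hgx t ht]
    exact (hx t).hasDerivAt
  have hφ : HasDerivAt (fun y => deriv x (g y)) (f (x t, deriv x t) * (deriv x t)⁻¹) (x t) := by
    refine HasDerivAt.comp (h₂ := deriv x) (x t) ?_ hgd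
    rw [hgx t ht, ← hode t]
    exact (hx' t).hasDerivAt
  refine ⟨hφ.differentiableAt, ?_⟩
  simp only [hφ.deriv, hgx t ht]
  field_simp
end

section
/- Let A ∈ ℝ and let x : ℝ → ℝ be twice differentiable with x''(t) = −x(t) · (1 + x'(t)²) for all t, x(0) = A, and x'(0) = 0. Then for all t ∈ ℝ: exp(x(t)²) · (1 + x'(t)²) = exp(A²). In particular x'(t)² = exp(A² − x(t)²) − 1 and x(t)² ≤ A² for all t. -/
/-- For solutions of `ẍ = −x·(1 + ẋ²)`, the quantity `e^{x²}(1 + ẋ²)` has zero derivative. -/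
theorem hasDerivAt_mickens_firstIntegral {x v : ℝ → ℝ} {t : ℝ} (hx : HasDerivAt x (v t) t)
    (hv : HasDerivAt v (-x t * (1 + v t ^ 2)) t) :
    HasDerivAt (fun s => Real.exp (x s ^ 2) * (1 + v s ^ 2)) 0 t := by
  refine ((hx.pow 2).exp.mul ((hv.pow 2).const_add 1)).congr_deriv ?_
  simp only [Pi.pow_apply]
  push_cast
  ring

/-- First integral of Mickens' oscillator `ẍ = −x·(1 + ẋ²)` with `x(0) = A`,
`ẋ(0) = 0`: the quantity `e^{x²}(1 + ẋ²)` is conserved, yielding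
`ẋ² = e^{A²−x²} − 1` and `x² ≤ A²`. -/
theorem mickens_conserved_quantity
    (A : ℝ) (x : ℝ → ℝ)
    (hx : Differentiable ℝ x) (hx' : Differentiable ℝ (deriv x))
    (hode : ∀ t : ℝ, deriv (deriv x) t = -x t * (1 + (deriv x t) ^ 2))
    (hx0 : x 0 = A) (hv0 : deriv x 0 = 0) :
    ∀ t : ℝ,
      Real.exp ((x t) ^ 2) * (1 + (deriv x t) ^ 2) = Real.exp (A ^ 2) ∧
      (deriv x t) ^ 2 = Real.exp (A ^ 2 - (x t) ^ 2) - 1 ∧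
      (x t) ^ 2 ≤ A ^ 2 := by
  intro t
  have hderiv (s : ℝ) :=
    hasDerivAt_mickens_firstIntegral (hx s).hasDerivAt (hode s ▸ (hx' s).hasDerivAt)
  have hconst : Real.exp (x t ^ 2) * (1 + deriv x t ^ 2) = Real.exp (A ^ 2) := by
    simpa [hx0, hv0] using is_const_of_deriv_eq_zero
      (fun s => (hderiv s).differentiableAt) (fun s => (hderiv s).deriv) t 0
  have hsq : deriv x t ^ 2 = Real.exp (A ^ 2 - x t ^ 2) - 1 := by
    rw [Real.exp_sub, ← hconst, mul_div_cancel_left₀ _ (Real.exp_ne_zero _)]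
    ring
  refine ⟨hconst, hsq, ?_⟩
  have hexp : 1 ≤ Real.exp (A ^ 2 - x t ^ 2) := by linarith [sq_nonneg (deriv x t)]
  exact sub_nonneg.mp (Real.one_le_exp_iff.mp hexp)
end

section
/- Let A > 0, let τ > 0, and let x : ℝ → ℝ be twice differentiable with x''(t) = −x(t) · (1 + x'(t)²) for all t, x(0) = A, x'(0) = 0. Assume x(τ) = 0 and x'(t) < 0 for all t ∈ (0, τ). Then τ = ∫₀ᴬ 1/√(exp(A² − y²) − 1) dy (where the integral is the improper integral over (0, A), which converges and equals τ). -/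
/-- The first integral of Mickens' oscillator. -/
theorem mickens_first_integral {x : ℝ → ℝ}
    (hx : Differentiable ℝ x) (hx' : Differentiable ℝ (deriv x))
    (hode : ∀ t : ℝ, deriv (deriv x) t = -x t * (1 + (deriv x t) ^ 2)) (s t : ℝ) :
    Real.exp (x s ^ 2) * (1 + deriv x s ^ 2) = Real.exp (x t ^ 2) * (1 + deriv x t ^ 2) := by
  have hderiv : ∀ r, HasDerivAt (fun r => Real.exp (x r ^ 2) * (1 + deriv x r ^ 2)) 0 r := by
    intro r
    have h := (((hx r).hasDerivAt.pow 2).exp).mul (((hx' r).hasDerivAt.pow 2).const_add 1)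
    refine HasDerivAt.congr_deriv h ?_
    rw [hode]
    simp only [Pi.pow_apply]
    push_cast
    ring
  exact is_const_of_deriv_eq_zero (fun r => (hderiv r).differentiableAt)
    (fun r => (hderiv r).deriv) s t

/-- Quarter-period formula for Mickens' oscillator: the time `τ` for the
solution of `ẍ = −x(1 + ẋ²)`, `x(0) = A > 0`, `ẋ(0) = 0` to descend to
`x(τ) = 0` equals the (convergent) improper integral
`∫₀ᴬ dy/√(e^{A²−y²} − 1)`. -/
theorem mickens_quarter_period
    (A : ℝ) (hA : 0 < A) (τ : ℝ) (hτ : 0 < τ)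
    (x : ℝ → ℝ)
    (hx : Differentiable ℝ x) (hx' : Differentiable ℝ (deriv x))
    (hode : ∀ t : ℝ, deriv (deriv x) t = -x t * (1 + (deriv x t) ^ 2))
    (hx0 : x 0 = A) (hv0 : deriv x 0 = 0)
    (hxτ : x τ = 0) (hneg : ∀ t ∈ Set.Ioo 0 τ, deriv x t < 0) :
    MeasureTheory.IntegrableOn
        (fun y => 1 / Real.sqrt (Real.exp (A ^ 2 - y ^ 2) - 1))
        (Set.Ioo 0 A) ∧
      τ = ∫ y in Set.Ioo 0 A,
            1 / Real.sqrt (Real.exp (A ^ 2 - y ^ 2) - 1) := by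
  have hanti : StrictAntiOn x (Set.Icc 0 τ) :=
    strictAntiOn_of_deriv_neg (convex_Icc 0 τ) hx.continuous.continuousOn
      (by simpa only [interior_Icc] using hneg)
  have himage : x '' Set.Ioo 0 τ = Set.Ioo 0 A := by
    apply Set.Subset.antisymm
    · rintro _ ⟨t, ht, rfl⟩
      have htc := Set.Ioo_subset_Icc_self ht
      exact ⟨hxτ ▸ hanti htc (Set.right_mem_Icc.2 hτ.le) ht.2,
        hx0 ▸ hanti (Set.left_mem_Icc.2 hτ.le) htc ht.1⟩
    · have h := intermediate_value_Ioo' hτ.le hx.continuous.continuousOn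
      rwa [hx0, hxτ] at h
  have hspeed : ∀ t ∈ Set.Ioo 0 τ,
      (-deriv x t) • (1 / Real.sqrt (Real.exp (A ^ 2 - x t ^ 2) - 1)) = 1 := by
    intro t ht
    have henergy := mickens_first_integral hx hx' hode t 0
    have hsq : Real.exp (A ^ 2 - x t ^ 2) - 1 = (-deriv x t) ^ 2 := by
      rw [hx0, hv0] at henergy
      rw [Real.exp_sub, sub_eq_iff_eq_add, div_eq_iff (Real.exp_ne_zero _)]
      linarith
    have hpos : 0 < -deriv x t := neg_pos.2 (hneg t ht)
    rw [hsq, Real.sqrt_sq hpos.le, smul_eq_mul, mul_one_div_cancel hpos.ne']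
  have hderiv : ∀ t ∈ Set.Ioo 0 τ, HasDerivWithinAt x (deriv x t) (Set.Ioo 0 τ) t :=
    fun t _ => (hx t).hasDerivAt.hasDerivWithinAt
  have hanti' : AntitoneOn x (Set.Ioo 0 τ) := hanti.antitoneOn.mono Set.Ioo_subset_Icc_self
  rw [← himage]
  constructor
  · rw [MeasureTheory.integrableOn_image_iff_integrableOn_deriv_smul_of_antitoneOn
      measurableSet_Ioo hderiv hanti',
      MeasureTheory.integrableOn_congr_fun hspeed measurableSet_Ioo]
    exact MeasureTheory.integrableOn_const (by simp)
  · rw [MeasureTheory.integral_image_eq_integral_deriv_smul_of_antitoneOn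
      measurableSet_Ioo hderiv hanti',
      MeasureTheory.setIntegral_congr_fun measurableSet_Ioo hspeed]
    simp [hτ.le]
end
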